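/- arXiv:2101.06260 — 2 statements merged into one kernel-verified Lean document; each statement's English description precedes it below -/
import Mathlib

section
/- For all non-negative integers n, j and all integers r ≥ 2, b_{≤j,r}(n) = (r−1)·(j+1)·|D_{j+1,r}(n)|. -/
open Finset

/-- The number of parts of a partition. -/
def numParts {n : ℕ} (p : Nat.Partition n) : ℕ := Multiset.card p.parts

/-- The number of different parts of a partition. -/
def numDistinctParts {n : ℕ} (p : Nat.Partition n) : ℕ := p.parts.toFinset.card

/-- `O_{j,r}(n)`: partitions of `n` with exactly `j` different parts divisible by `r`. -/
def setO (j r n : ℕ) : Finset (Nat.Partition n) :=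
  Finset.univ.filter fun p => (p.parts.toFinset.filter fun i => r ∣ i).card = j

/-- `D_{j,r}(n)`: partitions of `n` with exactly `j` different parts repeated at least `r`
times (all other parts appearing at most `r - 1` times). -/
def setD (j r n : ℕ) : Finset (Nat.Partition n) :=
  Finset.univ.filter fun p => (p.parts.toFinset.filter fun i => r ≤ p.parts.count i).card = j

/-- `O_{≤j,r}(n)`: partitions of `n` with at most `j` different parts divisible by `r`. -/
def setOle (j r n : ℕ) : Finset (Nat.Partition n) :=
  Finset.univ.filter fun p => (p.parts.toFinset.filter fun i => r ∣ i).card ≤ j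

/-- `D_{≤j,r}(n)`: partitions of `n` with at most `j` different parts repeated at least `r`
times (all other parts appearing at most `r - 1` times). -/
def setDle (j r n : ℕ) : Finset (Nat.Partition n) :=
  Finset.univ.filter fun p => (p.parts.toFinset.filter fun i => r ≤ p.parts.count i).card ≤ j

/-- `ℓ_t(λ)`: the number of parts of `λ` congruent to `t` modulo `r`, counted with
multiplicity. -/
def ellMod {n : ℕ} (r t : ℕ) (p : Nat.Partition n) : ℕ :=
  Multiset.card (p.parts.filter fun i => i % r = t)

/-- `ℓ̄_t(λ)`: the number of different parts of `λ` whose residual multiplicity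
(multiplicity mod `r`) is at least `t`. -/
def ellBarMod {n : ℕ} (r t : ℕ) (p : Nat.Partition n) : ℕ :=
  (p.parts.toFinset.filter fun i => t ≤ p.parts.count i % r).card

/-- `b_{j,r}(n)`: the difference between the number of parts in all partitions in
`O_{j,r}(n)` and the number of parts in all partitions in `D_{j,r}(n)`. -/
def bDiff (j r n : ℕ) : ℤ :=
  (∑ p ∈ setO j r n, (numParts p : ℤ)) - ∑ p ∈ setD j r n, (numParts p : ℤ)

/-- `b_{≤j,r}(n)`. -/
def bDiffLe (j r n : ℕ) : ℤ :=
  (∑ p ∈ setOle j r n, (numParts p : ℤ)) - ∑ p ∈ setDle j r n, (numParts p : ℤ)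

/-- `E_{j,r,t}(n)`. -/
def EDiff (j r t n : ℕ) : ℤ :=
  (∑ p ∈ setO j r n, ((ellMod r t p : ℤ) - (ellMod r 0 p : ℤ))) -
    ∑ p ∈ setD j r n, (ellBarMod r t p : ℤ)

/-- `b'_{j,r}(n)`: the difference between the number of different parts in all partitions in
`D_{j,r}(n)` and the number of different parts in all partitions in `O_{j,r}(n)`. -/
def bDiff' (j r n : ℕ) : ℤ :=
  (∑ p ∈ setD j r n, (numDistinctParts p : ℤ)) - ∑ p ∈ setO j r n, (numDistinctParts p : ℤ)

/-- `b'_{≤j,r}(n)`. -/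
def bDiffLe' (j r n : ℕ) : ℤ :=
  (∑ p ∈ setDle j r n, (numDistinctParts p : ℤ)) - ∑ p ∈ setOle j r n, (numDistinctParts p : ℤ)

/-- `T_{j,r}(n)`: the number of different parts with multiplicity between `r + 1` and
`2r - 1` in all partitions in `D_{j,r}(n)`. -/
def Tcount (j r n : ℕ) : ℕ :=
  ∑ p ∈ setD j r n,
    (p.parts.toFinset.filter fun i =>
      r + 1 ≤ p.parts.count i ∧ p.parts.count i ≤ 2 * r - 1).card

/-- Different parts divisible by `r`. -/
def divParts {n : ℕ} (r : ℕ) (p : Nat.Partition n) : Finset ℕ :=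
  p.parts.toFinset.filter fun i => r ∣ i

/-- Different parts repeated at least `r` times. -/
def repParts {n : ℕ} (r : ℕ) (p : Nat.Partition n) : Finset ℕ :=
  p.parts.toFinset.filter fun i => r ≤ p.parts.count i

/-- The chosen parts, as multiset, are contained in the partition (divisible case). -/
lemma val_le_of_subset_div {n r : ℕ} {p : Nat.Partition n} {S : Finset ℕ}
    (h : S ⊆ divParts r p) : S.val ≤ p.parts := by
  rw [Multiset.le_iff_subset S.nodup]
  intro x hx
  have := h hx
  simp only [divParts, mem_filter, Multiset.mem_toFinset] at this
  exact this.1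

/-- `r` copies of the chosen parts are contained in the partition (repeated case). -/
lemma nsmul_val_le_of_subset_rep {n r : ℕ} {p : Nat.Partition n} {T : Finset ℕ}
    (h : T ⊆ repParts r p) : r • T.val ≤ p.parts := by
  rw [Multiset.le_iff_count]
  intro x
  rw [Multiset.count_nsmul]
  by_cases hx : x ∈ T
  · have := h hx
    simp only [repParts, mem_filter, Multiset.mem_toFinset] at this
    rw [Multiset.count_eq_one_of_mem T.nodup hx]
    omega
  · rw [Multiset.count_eq_zero_of_notMem hx]
    omega

lemma div_image_val {r : ℕ} (hr : 2 ≤ r) {S : Finset ℕ} (h : ∀ x ∈ S, r ∣ x) :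
    (S.image (· / r)).val.map (r * ·) = S.val := by
  have h1 : (S.image (· / r)).image (r * ·) = S := by
    rw [Finset.image_image]
    conv_rhs => rw [← Finset.image_id (s := S)]
    apply Finset.image_congr
    intro x hx
    exact Nat.mul_div_cancel' (h x hx)
  have hinj : Function.Injective (r * ·) := fun a b hab =>
    Nat.eq_of_mul_eq_mul_left (by omega : 0 < r) hab
  conv_rhs => rw [← h1]
  rw [Finset.image_val_of_injOn hinj.injOn]

lemma mul_image_val {r : ℕ} (hr : 2 ≤ r) (T : Finset ℕ) :
    (T.image (r * ·)).val = T.val.map (r * ·) := by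
  have hinj : Function.Injective (r * ·) := fun a b hab =>
    Nat.eq_of_mul_eq_mul_left (by omega : 0 < r) hab
  rw [Finset.image_val_of_injOn hinj.injOn]

lemma mul_image_div {r : ℕ} (hr : 2 ≤ r) (T : Finset ℕ) :
    (T.image (r * ·)).image (· / r) = T := by
  rw [Finset.image_image]
  conv_rhs => rw [← Finset.image_id (s := T)]
  apply Finset.image_congr
  intro x _
  exact Nat.mul_div_cancel_left x (by omega)

lemma sum_map_mul (r : ℕ) (T : Multiset ℕ) : (T.map (r * ·)).sum = r * T.sum := by
  simpa using Multiset.sum_map_mul_left (s := T) (a := r) (f := fun x => x)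

/-- Split every chosen part divisible by `r` (once) into `r` equal parts. -/
def splitPart {n r : ℕ} (hr : 2 ≤ r) (p : Nat.Partition n) (S : Finset ℕ)
    (h : S ⊆ divParts r p) : Nat.Partition n where
  parts := p.parts - S.val + r • (S.image (· / r)).val
  parts_pos := by
    intro i hi
    rw [Multiset.mem_add] at hi
    rcases hi with hi | hi
    · exact p.parts_pos (Multiset.mem_of_le tsub_le_self hi)
    · have hi := Multiset.mem_of_mem_nsmul hi
      rw [Finset.mem_val, Finset.mem_image] at hi
      obtain ⟨x, hx, rfl⟩ := hi
      have hx := h hx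
      simp only [divParts, mem_filter, Multiset.mem_toFinset] at hx
      exact Nat.div_pos (Nat.le_of_dvd (p.parts_pos hx.1) hx.2) (by omega)
  parts_sum := by
    have hd : ∀ x ∈ S, r ∣ x := fun x hx => (Finset.mem_filter.1 (h hx)).2
    have h1 : (p.parts - S.val).sum + S.val.sum = n := by
      rw [← Multiset.sum_add, tsub_add_cancel_of_le (val_le_of_subset_div h), p.parts_sum]
    rw [← div_image_val hr hd, sum_map_mul, div_image_val hr hd] at h1
    rw [Multiset.sum_add, Multiset.sum_nsmul, smul_eq_mul, h1]

/-- Merge `r` copies of every chosen part. -/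
def mergePart {n r : ℕ} (hr : 2 ≤ r) (p : Nat.Partition n) (T : Finset ℕ)
    (h : T ⊆ repParts r p) : Nat.Partition n where
  parts := p.parts - r • T.val + (T.image (r * ·)).val
  parts_pos := by
    intro i hi
    rw [Multiset.mem_add] at hi
    rcases hi with hi | hi
    · exact p.parts_pos (Multiset.mem_of_le tsub_le_self hi)
    · rw [Finset.mem_val, Finset.mem_image] at hi
      obtain ⟨x, hx, rfl⟩ := hi
      have hx := h hx
      simp only [repParts, mem_filter, Multiset.mem_toFinset] at hx
      exact Nat.mul_pos (by omega) (p.parts_pos hx.1)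
  parts_sum := by
    have h1 : (p.parts - r • T.val).sum + (r • T.val).sum = n := by
      rw [← Multiset.sum_add, tsub_add_cancel_of_le (nsmul_val_le_of_subset_rep h), p.parts_sum]
    rw [Multiset.sum_nsmul, smul_eq_mul] at h1
    rw [Multiset.sum_add, mul_image_val hr, sum_map_mul, h1]

lemma split_subset {n r : ℕ} (hr : 2 ≤ r) (p : Nat.Partition n) (S : Finset ℕ)
    (h : S ⊆ divParts r p) : S.image (· / r) ⊆ repParts r (splitPart hr p S h) := by
  intro x hx
  have hc : r ≤ (splitPart hr p S h).parts.count x := by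
    simp only [splitPart, Multiset.count_add, Multiset.count_nsmul]
    rw [Multiset.count_eq_one_of_mem (S.image (· / r)).nodup hx]
    omega
  simp only [repParts, mem_filter, Multiset.mem_toFinset]
  exact ⟨Multiset.count_pos.1 (by omega), hc⟩

lemma merge_subset {n r : ℕ} (hr : 2 ≤ r) (p : Nat.Partition n) (T : Finset ℕ)
    (h : T ⊆ repParts r p) : T.image (r * ·) ⊆ divParts r (mergePart hr p T h) := by
  intro x hx
  simp only [divParts, mem_filter, Multiset.mem_toFinset, mergePart]
  refine ⟨Multiset.mem_add.2 (Or.inr hx), ?_⟩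
  obtain ⟨y, _, rfl⟩ := Finset.mem_image.1 hx
  exact Dvd.intro _ rfl

lemma div_image_mul {r : ℕ} (hr : 2 ≤ r) {S : Finset ℕ} (h : ∀ x ∈ S, r ∣ x) :
    (S.image (· / r)).image (r * ·) = S := by
  apply Finset.val_injective
  rw [mul_image_val hr, div_image_val hr h]

lemma card_div_image {r : ℕ} (hr : 2 ≤ r) {S : Finset ℕ} (h : ∀ x ∈ S, r ∣ x) :
    (S.image (· / r)).card = S.card := by
  have := congrArg Multiset.card (div_image_val hr h)
  rwa [Multiset.card_map, Finset.card_val, Finset.card_val] at this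

lemma card_mul_image {r : ℕ} (hr : 2 ≤ r) (T : Finset ℕ) :
    (T.image (r * ·)).card = T.card := by
  have := congrArg Multiset.card (mul_image_val hr T)
  rwa [Multiset.card_map, Finset.card_val, Finset.card_val] at this

lemma card_split {n r : ℕ} (hr : 2 ≤ r) (p : Nat.Partition n) (S : Finset ℕ)
    (h : S ⊆ divParts r p) :
    numParts (splitPart hr p S h) + S.card = numParts p + r * S.card := by
  have hd : ∀ x ∈ S, r ∣ x := fun x hx => (Finset.mem_filter.1 (h hx)).2
  have h1 : Multiset.card (p.parts - S.val) + S.card = Multiset.card p.parts := by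
    rw [← Finset.card_val, ← Multiset.card_add, tsub_add_cancel_of_le (val_le_of_subset_div h)]
  simp only [numParts, splitPart, Multiset.card_add, Multiset.card_nsmul, Finset.card_val,
    card_div_image hr hd]
  omega

/-- The bijection, as an identity of sums. -/
lemma pair_sum {n r : ℕ} (hr : 2 ≤ r) (k : ℕ) :
    ∑ p : Nat.Partition n, ∑ _S ∈ (divParts r p).powersetCard k, (numParts p : ℤ) =
    ∑ p : Nat.Partition n, ∑ _T ∈ (repParts r p).powersetCard k,
      ((numParts p : ℤ) - ((r : ℤ) - 1) * k) := by
  rw [Finset.sum_sigma', Finset.sum_sigma']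
  have hA : ∀ a : (Σ _ : Nat.Partition n, Finset ℕ),
      a ∈ (univ : Finset (Nat.Partition n)).sigma (fun p => (divParts r p).powersetCard k) →
      a.2 ⊆ divParts r a.1 ∧ a.2.card = k := by
    intro a ha
    simpa [Finset.mem_powersetCard] using ha
  have hB : ∀ a : (Σ _ : Nat.Partition n, Finset ℕ),
      a ∈ (univ : Finset (Nat.Partition n)).sigma (fun p => (repParts r p).powersetCard k) →
      a.2 ⊆ repParts r a.1 ∧ a.2.card = k := by
    intro a ha
    simpa [Finset.mem_powersetCard] using ha
  have hd : ∀ (p : Nat.Partition n) (S : Finset ℕ), S ⊆ divParts r p → ∀ x ∈ S, r ∣ x :=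
    fun p S h x hx => (Finset.mem_filter.1 (h hx)).2
  refine Finset.sum_bij'
    (fun a ha => ⟨splitPart hr a.1 a.2 (hA a ha).1, a.2.image (· / r)⟩)
    (fun a ha => ⟨mergePart hr a.1 a.2 (hB a ha).1, a.2.image (r * ·)⟩) ?_ ?_ ?_ ?_ ?_
  · intro a ha
    have h := hA a ha
    simp only [Finset.mem_sigma, Finset.mem_univ, true_and, Finset.mem_powersetCard]
    exact ⟨split_subset hr _ _ h.1, (card_div_image hr (hd _ _ h.1)).trans h.2⟩
  · intro a ha
    have h := hB a ha
    simp only [Finset.mem_sigma, Finset.mem_univ, true_and, Finset.mem_powersetCard]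
    exact ⟨merge_subset hr _ _ h.1, (card_mul_image hr _).trans h.2⟩
  · intro a ha
    have h := hA a ha
    refine Sigma.ext ?_ (heq_of_eq (div_image_mul hr (hd _ _ h.1)))
    apply Nat.Partition.ext
    simp only [mergePart, splitPart]
    rw [div_image_mul hr (hd _ _ h.1), add_tsub_cancel_right,
      tsub_add_cancel_of_le (val_le_of_subset_div h.1)]
  · intro a ha
    have h := hB a ha
    refine Sigma.ext ?_ (heq_of_eq (mul_image_div hr _))
    apply Nat.Partition.ext
    simp only [mergePart, splitPart]
    rw [mul_image_div hr, add_tsub_cancel_right,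
      tsub_add_cancel_of_le (nsmul_val_le_of_subset_rep h.1)]
  · intro a ha
    have h := hA a ha
    have h2 := card_split hr a.1 a.2 h.1
    simp only [h.2] at h2
    have h3 : (numParts (splitPart hr a.1 a.2 h.1) : ℤ) + k = numParts a.1 + r * k := by
      exact_mod_cast h2
    simp only
    linarith

lemma choose_sum {n r : ℕ} (hr : 2 ≤ r) (k : ℕ) :
    ∑ p : Nat.Partition n, ((divParts r p).card.choose k : ℤ) * (numParts p : ℤ) =
    ∑ p : Nat.Partition n, ((repParts r p).card.choose k : ℤ) *
      ((numParts p : ℤ) - ((r : ℤ) - 1) * k) := by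
  have := pair_sum (n := n) hr k
  simpa only [Finset.sum_const, Finset.card_powersetCard, nsmul_eq_mul] using this

/-- `i (C(i-1,k) - C(i,k)) = -k C(i,k)`. -/
lemma choose_identity (i k : ℕ) :
    (i : ℤ) * (((i - 1).choose k : ℤ) - (i.choose k : ℤ)) = - (k * (i.choose k : ℤ)) := by
  cases i with
  | zero => cases k <;> simp
  | succ i =>
    cases k with
    | zero => simp
    | succ k =>
      have h1 := Nat.add_one_mul_choose_eq i k
      have h2 := Nat.choose_succ_succ i k
      have hh1 : ((i : ℤ) + 1) * (i.choose k : ℤ) = ((i + 1).choose (k + 1) : ℤ) * (k + 1) := by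
        exact_mod_cast h1
      have hh2 : ((i + 1).choose (k + 1) : ℤ) = i.choose k + i.choose (k + 1) := by
        exact_mod_cast h2
      simp only [Nat.add_sub_cancel]
      push_cast
      linear_combination -hh1 - ((i : ℤ) + 1) * hh2

/-- Newton expansion on an initial segment. -/
lemma newton (f : ℕ → ℤ) (N : ℕ) :
    ∃ c : ℕ → ℤ, ∀ i ≤ N, f i = ∑ k ∈ range (N + 1), c k * (i.choose k : ℤ) := by
  refine ⟨fun k => (fwdDiff 1)^[k] f 0, fun i hi => ?_⟩
  have h := shift_eq_sum_fwdDiff_iter (h := (1 : ℕ)) f i 0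
  simp only [zero_add, smul_eq_mul, mul_one] at h
  rw [h]
  have hsub : range (i + 1) ⊆ range (N + 1) := Finset.range_subset_range.2 (by omega)
  rw [← Finset.sum_subset hsub]
  · apply Finset.sum_congr rfl
    intro k _
    rw [nsmul_eq_mul, mul_comm]
  · intro k _ hk
    rw [Finset.mem_range] at hk
    rw [Nat.choose_eq_zero_of_lt (by omega)]
    simp

lemma general_sum {n r : ℕ} (hr : 2 ≤ r) (f : ℕ → ℤ) :
    ∑ p : Nat.Partition n, f (divParts r p).card * (numParts p : ℤ) =
    ∑ p : Nat.Partition n, (f (repParts r p).card * (numParts p : ℤ) +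
      ((r : ℤ) - 1) * ((repParts r p).card *
        (f ((repParts r p).card - 1) - f (repParts r p).card))) := by
  obtain ⟨N, hN⟩ : ∃ N, ∀ p : Nat.Partition n,
      (divParts r p).card ≤ N ∧ (repParts r p).card ≤ N := by
    refine ⟨∑ p : Nat.Partition n, ((divParts r p).card + (repParts r p).card), fun p => ?_⟩
    have := Finset.single_le_sum
      (f := fun p : Nat.Partition n => (divParts r p).card + (repParts r p).card)
      (fun _ _ => Nat.zero_le _) (Finset.mem_univ p)
    omega
  obtain ⟨c, hc⟩ := newton f N
  have hL : ∑ p : Nat.Partition n, f (divParts r p).card * (numParts p : ℤ) =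
      ∑ k ∈ range (N + 1), c k *
        ∑ p : Nat.Partition n, ((divParts r p).card.choose k : ℤ) * (numParts p : ℤ) := by
    simp_rw [Finset.mul_sum]
    rw [Finset.sum_comm]
    apply Finset.sum_congr rfl
    intro p _
    rw [hc _ (hN p).1, Finset.sum_mul]
    exact Finset.sum_congr rfl fun k _ => by ring
  rw [hL]
  simp_rw [choose_sum hr, Finset.mul_sum]
  rw [Finset.sum_comm]
  apply Finset.sum_congr rfl
  intro p _
  rw [hc _ (hN p).2, hc ((repParts r p).card - 1) (by have := (hN p).2; omega),
    ← Finset.sum_sub_distrib, Finset.sum_mul, Finset.mul_sum, Finset.mul_sum,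
    ← Finset.sum_add_distrib]
  apply Finset.sum_congr rfl
  intro k _
  linear_combination (-((r : ℤ) - 1) * c k) * choose_identity (repParts r p).card k

/-- `b_{≤j,r}(n) = (r-1)·(j+1)·|D_{j+1,r}(n)|`. -/
theorem bDiffLe_eq_D (n j r : ℕ) (hr : 2 ≤ r) :
    bDiffLe j r n = ((r : ℤ) - 1) * ((j : ℤ) + 1) * ((setD (j + 1) r n).card : ℤ) := by
  have h := general_sum (n := n) hr (fun i => if i ≤ j then 1 else 0)
  rw [Finset.sum_add_distrib] at h
  have h1 : ∑ p ∈ setOle j r n, (numParts p : ℤ) = ∑ p : Nat.Partition n,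
      (if (divParts r p).card ≤ j then (1 : ℤ) else 0) * (numParts p : ℤ) := by
    simp only [ite_mul, one_mul, zero_mul, ← Finset.sum_filter]
    rfl
  have h2 : ∑ p ∈ setDle j r n, (numParts p : ℤ) = ∑ p : Nat.Partition n,
      (if (repParts r p).card ≤ j then (1 : ℤ) else 0) * (numParts p : ℤ) := by
    simp only [ite_mul, one_mul, zero_mul, ← Finset.sum_filter]
    rfl
  have h3 : ((setD (j + 1) r n).card : ℤ) = ∑ p : Nat.Partition n,
      (if (repParts r p).card = j + 1 then (1 : ℤ) else 0) := by
    rw [Finset.sum_boole]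
    rfl
  rw [bDiffLe, h1, h2, h, h3, add_sub_cancel_left, Finset.mul_sum]
  apply Finset.sum_congr rfl
  intro p _
  generalize (repParts r p).card = i
  rcases lt_trichotomy i (j + 1) with hi | hi | hi
  · rw [if_pos (by omega), if_pos (by omega), if_neg (by omega)]
    ring
  · subst hi
    simp
  · rw [if_neg (by omega), if_neg (by omega), if_neg (by omega)]
    ring
end

section
/- For all integers n, j, r, t with n, j ≥ 0, r ≥ 2 and 1 ≤ t ≤ r−1, E_{j,r,t}(n) = (j+1)·|O_{j+1,r}(n)| − j·|O_{j,r}(n)|, where the equality holds in the integers. -/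
open Finset

section GlaisherRefined
open PowerSeries PowerSeries.WithPiTopology

theorem tsum_aux {R : Type*} [CommRing R] [TopologicalSpace R] [T2Space R] [IsTopologicalRing R]
    (z : R) (y : R⟦X⟧) (hy : constantCoeff y = 0) (r : ℕ) (hr : 1 ≤ r) :
    (1 + ∑' c : ℕ, (if r ≤ c + 1 then z else 1) • y ^ (c + 1)) * (1 - y) =
      1 - y ^ r + z • y ^ r := by
  have hs : Summable fun c : ℕ => y ^ c := summable_pow_of_constantCoeff_eq_zero hy
  have hsr : Summable fun c : ℕ => z • y ^ (c + r) := by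
    simp_rw [pow_add, PowerSeries.smul_eq_C_mul, ← mul_assoc]
    exact (hs.mul_left _).mul_right _
  set g : ℕ → R⟦X⟧ := fun c => (if r ≤ c then z else 1) • y ^ c with hg
  have hgr : (fun c => g (c + r)) = fun c => z • y ^ (c + r) := by
    funext c; simp [hg]
  have hgs : Summable g := by
    rw [← summable_nat_add_iff r, hgr]; exact hsr
  have h0 : g 0 = 1 := by
    have : ¬ r ≤ 0 := by omega
    simp [hg, this]
  have h1 : 1 + ∑' c : ℕ, (if r ≤ c + 1 then z else 1) • y ^ (c + 1) = ∑' c, g c := by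
    rw [hgs.tsum_eq_zero_add, h0]
  have h2 : ∑' c, g c = ∑ c ∈ Finset.range r, y ^ c + z • y ^ r * ∑' c, y ^ c := by
    rw [← hgs.sum_add_tsum_nat_add r, hgr]
    congr 1
    · refine Finset.sum_congr rfl fun c hc => ?_
      have : ¬ r ≤ c := by simpa using hc
      simp [hg, this]
    · rw [← hs.tsum_mul_left]
      refine tsum_congr fun c => ?_
      rw [pow_add, smul_mul_assoc, mul_comm]
  rw [h1, h2, add_mul, geom_sum_mul_neg, mul_assoc,
    tsum_pow_mul_one_sub_of_constantCoeff_eq_zero hy, mul_one]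

theorem genFun_eq {R : Type*} [CommRing R] [NoZeroDivisors R] [Nontrivial R]
    (z : R) (r : ℕ) (hr : 1 ≤ r) :
    Nat.Partition.genFun (fun i _ => if r ∣ i then z else 1) =
      Nat.Partition.genFun (fun _ c => if r ≤ c then z else 1) := by
  let _ : TopologicalSpace R := ⊥
  have _ : DiscreteTopology R := ⟨rfl⟩
  apply mul_right_cancel₀ (tprod_one_sub_X_pow_ne_zero R)
  rw [Nat.Partition.genFun_eq_tprod, Nat.Partition.genFun_eq_tprod,
    ← (Nat.Partition.multipliable_genFun (fun i _ => if r ∣ i then z else 1)).tprod_mul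
      (multipliable_one_sub_X_pow R),
    ← (Nat.Partition.multipliable_genFun (fun _ c => if r ≤ c then z else 1)).tprod_mul
      (multipliable_one_sub_X_pow R)]
  have hR : ∀ i : ℕ, ((1 : R⟦X⟧) + ∑' j : ℕ, (if r ≤ j + 1 then z else 1) •
      (X : R⟦X⟧) ^ ((i + 1) * (j + 1))) * (1 - X ^ (i + 1)) =
      1 - X ^ ((i + 1) * r) + z • X ^ ((i + 1) * r) := by
    intro i
    simp_rw [pow_mul]
    exact tsum_aux z _ (by simp) r hr
  have hL : ∀ i : ℕ, ((1 : R⟦X⟧) + ∑' j : ℕ, (if r ∣ i + 1 then z else 1) •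
      (X : R⟦X⟧) ^ ((i + 1) * (j + 1))) * (1 - X ^ (i + 1)) =
      if r ∣ i + 1 then 1 - X ^ (i + 1) + z • X ^ (i + 1) else 1 := by
    intro i
    simp_rw [pow_mul]
    have := tsum_aux (if r ∣ i + 1 then z else 1) ((X : R⟦X⟧) ^ (i + 1)) (by simp) 1 le_rfl
    simp only [Nat.le_add_left, if_true, pow_one] at this
    rw [this]
    split_ifs <;> simp
  rw [tprod_congr hL, tprod_congr hR]
  refine tprod_eq_tprod_of_ne_one_bij (fun i ↦ (i.val + 1) * r - 1) ?_ ?_ ?_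
  · intro a b h
    rw [tsub_left_inj (by nlinarith) (by nlinarith), mul_left_inj' (by omega), add_left_inj] at h
    exact SetCoe.ext h
  · intro i hi
    by_cases hd : r ∣ i + 1
    · obtain ⟨j, hj⟩ := hd
      have hj0 : j ≠ 0 := by rintro rfl; simp at hj
      have hj1 : j - 1 + 1 = j := by omega
      refine ⟨⟨j - 1, ?_⟩, ?_⟩
      · have hd : r ∣ i + 1 := ⟨j, hj⟩
        simp only [Function.mem_mulSupport, hd, if_true] at hi ⊢
        rw [hj1, mul_comm, ← hj]
        exact hi
      · simp only [hj1]
        rw [mul_comm, ← hj]; simp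
    · simp [hd] at hi
  · intro i
    have : (i.val + 1) * r - 1 + 1 = (i.val + 1) * r := by
      have : 0 < (i.val + 1) * r := by positivity
      omega
    simp [this]

end GlaisherRefined

theorem card_setO_eq_card_setD (j r n : ℕ) (hr : 1 ≤ r) :
    (setO j r n).card = (setD j r n).card := by
  have h := congrArg (PowerSeries.coeff n) (genFun_eq (Polynomial.X : Polynomial ℤ) r hr)
  have hpr : ∀ (s : Finset ℕ) (P : ℕ → Prop) [DecidablePred P],
      (∏ x ∈ s, if P x then (Polynomial.X : Polynomial ℤ) else 1) =
        Polynomial.X ^ (s.filter P).card := by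
    intro s P _
    rw [Finset.prod_ite]
    simp
  have hco : ∀ (S : Nat.Partition n → ℕ),
      (∑ p : Nat.Partition n, (Polynomial.X : Polynomial ℤ) ^ S p).coeff j =
        ((Finset.univ.filter fun p => S p = j).card : ℤ) := by
    intro S
    simp only [Polynomial.finsetSum_coeff, Polynomial.coeff_X_pow, Finset.sum_boole,
      eq_comm (a := j)]
  rw [Nat.Partition.coeff_genFun, Nat.Partition.coeff_genFun] at h
  have e1 : ∀ p : Nat.Partition n, (p.parts.toFinsupp.prod
      (fun i _ => if r ∣ i then (Polynomial.X : Polynomial ℤ) else 1)) =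
      Polynomial.X ^ (p.parts.toFinset.filter fun i => r ∣ i).card := fun p => by
    rw [← hpr]; simp [Finsupp.prod]
  have e2 : ∀ p : Nat.Partition n, (p.parts.toFinsupp.prod
      (fun _ c => if r ≤ c then (Polynomial.X : Polynomial ℤ) else 1)) =
      Polynomial.X ^ (p.parts.toFinset.filter fun i => r ≤ p.parts.count i).card := fun p => by
    rw [← hpr]; simp only [Finsupp.prod, Multiset.toFinsupp_support, Multiset.toFinsupp_apply]
    exact Finset.prod_congr rfl fun x _ => by congr
  rw [Finset.sum_congr rfl fun p _ => e1 p, Finset.sum_congr rfl fun p _ => e2 p] at h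
  have h2 := congrArg (fun p => Polynomial.coeff p j) h
  simp only [hco] at h2
  unfold setO setD
  exact_mod_cast h2

/-- number of different parts `x` satisfying `P x (multiplicity)`. -/
def dg (P : ℕ → ℕ → Prop) [∀ x c, Decidable (P x c)] (s : Multiset ℕ) : ℕ :=
  (s.toFinset.filter fun x => P x (s.count x)).card

/-- same, ignoring the part `m`. -/
def dgE (P : ℕ → ℕ → Prop) [∀ x c, Decidable (P x c)] (m : ℕ) (s : Multiset ℕ) : ℕ :=
  ((s.toFinset.erase m).filter fun x => P x (s.count x)).card

theorem dg_sub (P : ℕ → ℕ → Prop) [∀ x c, Decidable (P x c)] (m k : ℕ) (s : Multiset ℕ) :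
    dg P (s - Multiset.replicate k m) = dgE P m s +
      if k < s.count m ∧ P m (s.count m - k) then 1 else 0 := by
  unfold dg dgE
  have hcm : (s - Multiset.replicate k m).count m = s.count m - k := by simp
  have hcx : ∀ x, x ≠ m → (s - Multiset.replicate k m).count x = s.count x := by
    intro x hx
    simp [Multiset.count_replicate, hx.symm]
  have hE : ((s.toFinset.erase m).filter fun x => P x (s.count x)) =
      ((s - Multiset.replicate k m).toFinset.filter
        fun x => P x ((s - Multiset.replicate k m).count x)).erase m := by
    ext x
    by_cases hx : x = m
    · simp [hx]
    · simp only [Finset.mem_filter, Finset.mem_erase, Multiset.mem_toFinset,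
        ← Multiset.count_pos, hcx x hx, hx, ne_eq, not_false_eq_true, true_and]
  rw [hE]
  split_ifs with h
  · rw [Finset.card_erase_add_one]
    simp only [Finset.mem_filter, Multiset.mem_toFinset, ← Multiset.count_pos, hcm]
    exact ⟨by omega, h.2⟩
  · rw [Finset.erase_eq_of_notMem, add_zero]
    simp only [Finset.mem_filter, Multiset.mem_toFinset, ← Multiset.count_pos, hcm]
    rintro ⟨h1, h2⟩
    exact h ⟨by omega, h2⟩

theorem dg_eq (P : ℕ → ℕ → Prop) [∀ x c, Decidable (P x c)] (m : ℕ) (s : Multiset ℕ) :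
    dg P s = dgE P m s + if 0 < s.count m ∧ P m (s.count m) then 1 else 0 := by
  simpa using dg_sub P m 0 s

theorem shift_sum (n i k : ℕ) (hi : 1 ≤ i) (f : Multiset ℕ → ℤ) :
    (if i * k ≤ n then ∑ q : Nat.Partition (n - i * k), f q.parts else 0) =
      ∑ p : Nat.Partition n,
        if k ≤ p.parts.count i then f (p.parts - Multiset.replicate k i) else 0 := by
  have hle : ∀ p : Nat.Partition n, k ≤ p.parts.count i →
      p.parts - Multiset.replicate k i + Multiset.replicate k i = p.parts := fun p h =>
    Multiset.sub_add_cancel (Multiset.le_count_iff_replicate_le.mp h)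
  have hsum : ∀ p : Nat.Partition n, k ≤ p.parts.count i →
      (p.parts - Multiset.replicate k i).sum + i * k = n := by
    intro p h
    have := congrArg Multiset.sum (hle p h)
    rw [Multiset.sum_add, p.parts_sum, Multiset.sum_replicate, smul_eq_mul, mul_comm] at this
    exact this
  split_ifs with h
  · rw [← Finset.sum_filter]
    symm
    refine Finset.sum_bij'
      (fun p hp => ⟨p.parts - Multiset.replicate k i,
        fun {x} hx => p.parts_pos (Multiset.mem_of_le (Multiset.sub_le_self _ _) hx), ?_⟩)
      (fun q _ => ⟨q.parts + Multiset.replicate k i, ?_, ?_⟩) ?_ ?_ ?_ ?_ ?_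
    · have := hsum p (by simpa using hp)
      omega
    · intro x hx
      rcases Multiset.mem_add.mp hx with hx | hx
      · exact q.parts_pos hx
      · rw [Multiset.eq_of_mem_replicate hx]; omega
    · rw [Multiset.sum_add, q.parts_sum, Multiset.sum_replicate, smul_eq_mul, mul_comm k]
      omega
    · intro p hp; simp
    · intro q hq; simp
    · intro p hp
      exact Nat.Partition.ext (hle p (by simpa using hp))
    · intro q hq
      apply Nat.Partition.ext
      simp
    · intro p hp; rfl
  · symm
    refine Finset.sum_eq_zero fun p _ => ?_
    rw [if_neg]
    intro hk
    have := hsum p hk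
    omega

theorem count_le_n {n : ℕ} (p : Nat.Partition n) (i : ℕ) : p.parts.count i ≤ n := by
  by_cases hi : i ∈ p.parts
  · have h1 := p.parts_pos hi
    have h2 : Multiset.replicate (p.parts.count i) i ≤ p.parts :=
      Multiset.le_count_iff_replicate_le.mp le_rfl
    have h3 : (Multiset.replicate (p.parts.count i) i).sum ≤ p.parts.sum := by
      obtain ⟨u, hu⟩ := Multiset.le_iff_exists_add.mp h2
      conv_rhs => rw [hu]
      rw [Multiset.sum_add]
      exact Nat.le_add_right _ _
    rw [Multiset.sum_replicate, p.parts_sum, smul_eq_mul] at h3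
    nlinarith
  · simp [Multiset.count_eq_zero_of_notMem hi]

/-- the indicator of `a = b`. -/
def ind (a b : ℕ) : ℤ := if a = b then 1 else 0

theorem sumQ (n q a j : ℕ) (hq : q ≤ n) :
    (∑ k ∈ Finset.range (n + 1), if k ≤ q then ind (a + if k < q then 1 else 0) j else 0) =
      ind a j + q * ind (a + 1) j := by
  rw [← Finset.sum_filter]
  have : (Finset.range (n + 1)).filter (fun k => k ≤ q) = Finset.range (q + 1) := by
    ext k; simp; omega
  rw [this, Finset.sum_range_succ]
  have h2 : ∑ k ∈ Finset.range q, ind (a + if k < q then 1 else 0) j =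
      ∑ k ∈ Finset.range q, ind (a + 1) j :=
    Finset.sum_congr rfl fun k hk => by rw [if_pos (Finset.mem_range.mp hk)]
  rw [h2]
  simp [add_comm]

theorem range_eq_Icc (n : ℕ) (f : ℕ → ℤ) :
    ∑ k ∈ Finset.range (n + 1), f k = f 0 + ∑ k ∈ Finset.Icc 1 n, f k := by
  rw [Finset.sum_range_succ', add_comm]
  congr 1
  symm
  refine Finset.sum_bij' (fun k _ => k - 1) (fun k _ => k + 1) ?_ ?_ ?_ ?_ ?_ <;>
    simp +contextual <;> intros <;> omega

theorem pw2 (n c a j : ℕ) (hc : c ≤ n) :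
    (∑ k ∈ Finset.Icc 1 n, if k ≤ c then ind (a + if k < c then 1 else 0) j else 0) =
      if 0 < c then ind a j + ((c : ℤ) - 1) * ind (a + 1) j else 0 := by
  have h1 := sumQ n c a j hc
  rw [range_eq_Icc] at h1
  by_cases h : 0 < c
  · simp [h] at h1 ⊢
    linarith
  · have : c = 0 := by omega
    subst this
    simp at h1 ⊢

theorem sumQr (n r m a j : ℕ) (hr : 1 ≤ r) (hm : m ≤ n) :
    (∑ k ∈ Finset.range (n + 1),
      if r * k ≤ m then ind (a + if r * k < m ∧ r ≤ m - r * k then 1 else 0) j else 0) =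
      ind a j + (m / r : ℕ) * ind (a + 1) j := by
  rw [← sumQ n (m / r) a j ((Nat.div_le_self _ _).trans hm)]
  refine Finset.sum_congr rfl fun k _ => ?_
  have h1 : r * k ≤ m ↔ k ≤ m / r := by rw [Nat.le_div_iff_mul_le (by omega), mul_comm]
  have h2 : (r * k < m ∧ r ≤ m - r * k) ↔ k < m / r := by
    rw [← Nat.succ_le_iff (m := k), Nat.le_div_iff_mul_le (by omega), Nat.succ_mul, mul_comm k]
    omega
  simp only [h1, h2]

theorem pw3 (n r t e a j : ℕ) (hr : 2 ≤ r) (ht1 : 1 ≤ t) (ht2 : t ≤ r - 1) (he : e ≤ n) :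
    ((if t ≤ e % r then ind (a + if 0 < e ∧ r ≤ e then 1 else 0) j else 0) +
      ∑ k ∈ Finset.Icc 1 n,
        if r * k ≤ e then ind (a + if r * k < e ∧ r ≤ e - r * k then 1 else 0) j else 0) =
      ∑ k ∈ Finset.range (n + 1),
        if t + r * k ≤ e then
          ind (a + if t + r * k < e ∧ r ≤ e - (t + r * k) then 1 else 0) j else 0 := by
  have h1 := sumQr n r e a j (by omega) he
  rw [range_eq_Icc] at h1
  simp only [mul_zero, Nat.zero_le, if_true, Nat.sub_zero] at h1
  by_cases hte : t ≤ e
  · have h2 := sumQr n r (e - t) a j (by omega) (by omega)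
    have h3 : (∑ k ∈ Finset.range (n + 1),
        if t + r * k ≤ e then
          ind (a + if t + r * k < e ∧ r ≤ e - (t + r * k) then 1 else 0) j else 0) =
        ∑ k ∈ Finset.range (n + 1),
      if r * k ≤ e - t then
        ind (a + if r * k < e - t ∧ r ≤ e - t - r * k then 1 else 0) j else 0 := by
      refine Finset.sum_congr rfl fun k _ => ?_
      have i1 : t + r * k ≤ e ↔ r * k ≤ e - t := by omega
      have i2 : t + r * k < e ↔ r * k < e - t := by omega
      rw [← Nat.sub_sub]
      simp only [i1, i2]
    rw [h3, h2]
    have hdm := Nat.div_add_mod e r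
    have hlt := Nat.mod_lt e (show r > 0 by omega)
    by_cases hmod : t ≤ e % r
    · have hd : (e - t) / r = e / r := by
        have : e - t = (e % r - t) + r * (e / r) := by omega
        rw [this, Nat.add_mul_div_left _ _ (by omega), Nat.div_eq_of_lt (by omega)]
        omega
      rw [if_pos hmod, hd]
      linarith
    · have hge : r ≤ e := by
        by_contra hlt'
        rw [Nat.mod_eq_of_lt (by omega)] at hmod
        exact hmod hte
      have hq : 1 ≤ e / r := (Nat.one_le_div_iff (by omega)).mpr hge
      have hd : (e - t) / r = e / r - 1 := by
        obtain ⟨q, hq'⟩ : ∃ q, e / r = q + 1 := ⟨e / r - 1, by omega⟩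
        rw [hq'] at hdm ⊢
        rw [mul_add] at hdm
        have : e - t = (e % r + r - t) + r * q := by omega
        rw [this, Nat.add_mul_div_left _ _ (by omega), Nat.div_eq_of_lt (by omega)]
        omega
      have hc : (0 < e ∧ r ≤ e) := ⟨by omega, hge⟩
      rw [if_neg hmod, hd]
      rw [if_pos hc] at h1
      rw [Nat.cast_sub hq, Nat.cast_one]
      linarith
  · have hmod : ¬ t ≤ e % r := by
      rw [Nat.mod_eq_of_lt (by omega)]; exact hte
    have hR : (∑ k ∈ Finset.range (n + 1),
        if t + r * k ≤ e then
          ind (a + if t + r * k < e ∧ r ≤ e - (t + r * k) then 1 else 0) j else 0) = 0 :=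
      Finset.sum_eq_zero fun k _ => by rw [if_neg (by omega)]
    rw [if_neg hmod, hR]
    have hc : ¬ (0 < e ∧ r ≤ e) := by omega
    rw [if_neg hc, Nat.div_eq_of_lt (by omega)] at h1
    simp at h1 ⊢
    exact h1

/-- `|O_{j,r}(n - e)|`, zero if `e > n`. -/
def hN (j r n e : ℕ) : ℤ := if e ≤ n then ((setO j r (n - e)).card : ℤ) else 0

theorem card_setO_ind (j r n : ℕ) :
    ((setO j r n).card : ℤ) = ∑ p : Nat.Partition n, ind (dg (fun x _ => r ∣ x) p.parts) j := by
  unfold setO ind dg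
  rw [Finset.sum_boole]

theorem card_setD_ind (j r n : ℕ) :
    ((setD j r n).card : ℤ) = ∑ p : Nat.Partition n, ind (dg (fun _ c => r ≤ c) p.parts) j := by
  unfold setD ind dg
  rw [Finset.sum_boole]

theorem hN_O (j r n i k : ℕ) (hi : 1 ≤ i) :
    hN j r n (i * k) = ∑ p : Nat.Partition n, if k ≤ p.parts.count i then
      ind (dgE (fun x _ => r ∣ x) i p.parts + if k < p.parts.count i ∧ r ∣ i then 1 else 0) j
      else 0 := by
  unfold hN
  rw [card_setO_ind, shift_sum n i k hi (fun s => ind (dg (fun x _ => r ∣ x) s) j)]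
  simp only [dg_sub]

theorem hN_D (j r n i k : ℕ) (hr : 1 ≤ r) (hi : 1 ≤ i) :
    hN j r n (i * k) = ∑ p : Nat.Partition n, if k ≤ p.parts.count i then
      ind (dgE (fun _ c => r ≤ c) i p.parts +
        if k < p.parts.count i ∧ r ≤ p.parts.count i - k then 1 else 0) j
      else 0 := by
  unfold hN
  rw [card_setO_eq_card_setD _ _ _ hr, card_setD_ind,
    shift_sum n i k hi (fun s => ind (dg (fun _ c => r ≤ c) s) j)]
  simp only [dg_sub]

theorem mem_Icc_of_parts {n : ℕ} (p : Nat.Partition n) {i : ℕ} (hi : i ∈ p.parts) :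
    i ∈ Finset.Icc 1 n :=
  Finset.mem_Icc.mpr ⟨p.parts_pos hi, Nat.Partition.le_of_mem_parts hi⟩

theorem ellMod_sum {n : ℕ} (r t : ℕ) (p : Nat.Partition n) :
    (ellMod r t p : ℤ) =
      ∑ i ∈ (Finset.Icc 1 n).filter (fun i => i % r = t), (p.parts.count i : ℤ) := by
  unfold ellMod
  rw [← Multiset.sum_count_eq_card (s := (Finset.Icc 1 n).filter (fun i => i % r = t))]
  · push_cast
    refine Finset.sum_congr rfl fun i hi => ?_
    rw [Multiset.count_filter_of_pos (p := fun i => i % r = t) (Finset.mem_filter.mp hi).2]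
  · intro i hi
    rw [Multiset.mem_filter] at hi
    exact Finset.mem_filter.mpr ⟨mem_Icc_of_parts p hi.1, hi.2⟩

theorem ellBarMod_sum {n : ℕ} (r t : ℕ) (ht : 1 ≤ t) (p : Nat.Partition n) :
    (ellBarMod r t p : ℤ) =
      ∑ i ∈ Finset.Icc 1 n, if t ≤ p.parts.count i % r then 1 else 0 := by
  unfold ellBarMod
  rw [Finset.sum_boole]
  congr 2
  ext i
  simp only [Finset.mem_filter, Multiset.mem_toFinset]
  constructor
  · rintro ⟨h1, h2⟩
    exact ⟨mem_Icc_of_parts p h1, h2⟩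
  · rintro ⟨h1, h2⟩
    refine ⟨?_, h2⟩
    rw [← Multiset.count_pos]
    by_contra h0
    have : p.parts.count i = 0 := by omega
    rw [this] at h2
    simp at h2
    omega

theorem dgO_sum {n : ℕ} (r : ℕ) (p : Nat.Partition n) :
    (dg (fun x _ => r ∣ x) p.parts : ℤ) =
      ∑ i ∈ (Finset.Icc 1 n).filter (fun i => r ∣ i),
        if 0 < p.parts.count i then 1 else 0 := by
  unfold dg
  rw [Finset.sum_boole]
  congr 2
  ext i
  simp only [Finset.mem_filter, Multiset.mem_toFinset, Multiset.count_pos]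
  constructor
  · rintro ⟨h1, h2⟩
    exact ⟨⟨mem_Icc_of_parts p h1, h2⟩, h1⟩
  · rintro ⟨⟨_, h2⟩, h1⟩
    exact ⟨h1, h2⟩

theorem sum_setO (j r n : ℕ) (f : Nat.Partition n → ℤ) :
    ∑ p ∈ setO j r n, f p =
      ∑ p : Nat.Partition n, ind (dg (fun x _ => r ∣ x) p.parts) j * f p := by
  unfold setO
  rw [Finset.sum_filter]
  refine Finset.sum_congr rfl fun p _ => ?_
  unfold ind dg
  split_ifs <;> simp

theorem sum_setD (j r n : ℕ) (f : Nat.Partition n → ℤ) :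
    ∑ p ∈ setD j r n, f p =
      ∑ p : Nat.Partition n, ind (dg (fun _ c => r ≤ c) p.parts) j * f p := by
  unfold setD
  rw [Finset.sum_filter]
  refine Finset.sum_congr rfl fun p _ => ?_
  unfold ind dg
  split_ifs <;> simp

theorem partA (n j r t : ℕ) (hr : 2 ≤ r) (ht1 : 1 ≤ t) :
    ∑ p ∈ setO j r n, (ellMod r t p : ℤ) =
      ∑ m ∈ (Finset.Icc 1 n).filter (fun i => i % r = t),
        ∑ k ∈ Finset.Icc 1 n, hN j r n (m * k) := by
  rw [sum_setO]
  simp only [ellMod_sum, Finset.mul_sum]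
  rw [Finset.sum_comm]
  refine Finset.sum_congr rfl fun m hm => ?_
  rw [Finset.mem_filter, Finset.mem_Icc] at hm
  have hnd : ¬ r ∣ m := fun h => by
    have := Nat.mod_eq_zero_of_dvd h
    omega
  rw [Finset.sum_congr rfl fun k _ => hN_O j r n m k hm.1.1, Finset.sum_comm]
  refine Finset.sum_congr rfl fun p _ => ?_
  rw [dg_eq _ m]
  simp only [hnd, and_false, if_false, add_zero]
  rw [← Finset.sum_filter]
  have : (Finset.Icc 1 n).filter (fun k => k ≤ p.parts.count m) =
      Finset.Icc 1 (p.parts.count m) := by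
    ext k
    have := count_le_n p m
    simp only [Finset.mem_filter, Finset.mem_Icc]
    omega
  rw [this]
  simp [mul_comm]

theorem partC (n j r : ℕ) :
    ∑ m ∈ (Finset.Icc 1 n).filter (fun i => r ∣ i),
        ∑ k ∈ Finset.Icc 1 n, hN j r n (m * k) =
      ((j : ℤ) + 1) * ((setO (j + 1) r n).card : ℤ) - (j : ℤ) * ((setO j r n).card : ℤ) +
        ∑ p ∈ setO j r n, (ellMod r 0 p : ℤ) := by
  have h1 : ∀ m ∈ (Finset.Icc 1 n).filter (fun i => r ∣ i),
      ∑ k ∈ Finset.Icc 1 n, hN j r n (m * k) =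
      ∑ p : Nat.Partition n,
        (ind (dg (fun x _ => r ∣ x) p.parts) (j + 1) *
            (if 0 < p.parts.count m then 1 else 0) +
          ind (dg (fun x _ => r ∣ x) p.parts) j * (p.parts.count m : ℤ) -
          ind (dg (fun x _ => r ∣ x) p.parts) j *
            (if 0 < p.parts.count m then 1 else 0)) := by
    intro m hm
    rw [Finset.mem_filter, Finset.mem_Icc] at hm
    rw [Finset.sum_congr rfl fun k _ => hN_O j r n m k hm.1.1, Finset.sum_comm]
    refine Finset.sum_congr rfl fun p _ => ?_
    rw [dg_eq _ m]
    simp only [hm.2, and_true]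
    rw [pw2 _ _ _ _ (count_le_n p m)]
    split_ifs with h
    · have : ind (dgE (fun x _ => r ∣ x) m p.parts + 1) (j + 1) =
          ind (dgE (fun x _ => r ∣ x) m p.parts) j := by
        unfold ind; simp
      rw [this]; ring
    · have : p.parts.count m = 0 := by omega
      rw [this]; simp
  rw [Finset.sum_congr rfl h1, Finset.sum_comm, card_setO_ind, card_setO_ind, sum_setO,
    Finset.mul_sum, Finset.mul_sum, ← Finset.sum_sub_distrib, ← Finset.sum_add_distrib]
  refine Finset.sum_congr rfl fun p _ => ?_
  rw [Finset.sum_sub_distrib, Finset.sum_add_distrib, ← Finset.mul_sum, ← Finset.mul_sum,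
    ← Finset.mul_sum, ← dgO_sum, ellMod_sum]
  have hf : (Finset.Icc 1 n).filter (fun i => r ∣ i) =
      (Finset.Icc 1 n).filter (fun i => i % r = 0) :=
    Finset.filter_congr fun i _ => Nat.dvd_iff_mod_eq_zero
  rw [hf]
  have e : ∀ a b : ℕ, ind a b * (a : ℤ) = b * ind a b := by
    intro a b
    unfold ind
    split_ifs with h <;> simp [h]
  rw [e, e]
  push_cast
  ring

theorem partB (n j r t : ℕ) (hr : 2 ≤ r) (ht1 : 1 ≤ t) (ht2 : t ≤ r - 1) :
    ∑ p ∈ setD j r n, (ellBarMod r t p : ℤ) +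
      ∑ i ∈ Finset.Icc 1 n, ∑ k ∈ Finset.Icc 1 n, hN j r n (i * (r * k)) =
      ∑ i ∈ Finset.Icc 1 n, ∑ k ∈ Finset.range (n + 1), hN j r n (i * (t + r * k)) := by
  rw [sum_setD]
  simp only [ellBarMod_sum r t ht1, Finset.mul_sum]
  rw [Finset.sum_comm, ← Finset.sum_add_distrib]
  refine Finset.sum_congr rfl fun i hi => ?_
  rw [Finset.mem_Icc] at hi
  rw [Finset.sum_congr rfl fun k _ => hN_D j r n i (r * k) (by omega) hi.1,
    Finset.sum_congr rfl fun k _ => hN_D j r n i (t + r * k) (by omega) hi.1,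
    Finset.sum_comm (s := Finset.Icc 1 n), Finset.sum_comm (s := Finset.range (n + 1)),
    ← Finset.sum_add_distrib]
  refine Finset.sum_congr rfl fun p _ => ?_
  rw [dg_eq _ i, ← pw3 n r t _ _ j hr ht1 ht2 (count_le_n p i)]
  simp only [mul_ite, mul_one, mul_zero]

theorem hN_zero (j r n e : ℕ) (h : n < e) : hN j r n e = 0 := by
  unfold hN
  rw [if_neg (by omega)]

theorem reindex1 (n r t i : ℕ) (hr : 2 ≤ r) (ht1 : 1 ≤ t) (ht2 : t ≤ r - 1) (f : ℕ → ℤ)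
    (hf : ∀ m, n < m → f m = 0) (hi : 1 ≤ i) :
    ∑ m ∈ (Finset.Icc 1 n).filter (fun i => i % r = t), f (m * i) =
      ∑ k ∈ Finset.range (n + 1), f (i * (t + r * k)) := by
  have hmod : ∀ k, (t + r * k) % r = t := fun k => by
    rw [Nat.add_mul_mod_self_left, Nat.mod_eq_of_lt (by omega)]
  have hinj : Set.InjOn (fun k => t + r * k) (Finset.range (n + 1) : Set ℕ) := by
    intro a _ b _ h
    have h' : r * a = r * b := by simpa using h
    exact Nat.eq_of_mul_eq_mul_left (by omega) h'
  rw [← Finset.sum_image (g := fun k => t + r * k) (f := fun m => f (i * m)) hinj]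
  simp only [mul_comm i]
  apply Finset.sum_subset
  · intro m hm
    rw [Finset.mem_filter, Finset.mem_Icc] at hm
    rw [Finset.mem_image]
    refine ⟨m / r, ?_, ?_⟩
    · have := Nat.div_le_self m r
      rw [Finset.mem_range]; omega
    · have := Nat.div_add_mod m r
      omega
  · intro m hm hm'
    rw [Finset.mem_image] at hm
    obtain ⟨k, _, rfl⟩ := hm
    apply hf
    rw [Finset.mem_filter, Finset.mem_Icc] at hm'
    have h2 : n < t + r * k := by
      by_contra hc
      exact hm' ⟨by omega, hmod k⟩
    nlinarith

theorem reindex2 (n r i : ℕ) (hr : 2 ≤ r) (f : ℕ → ℤ)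
    (hf : ∀ m, n < m → f m = 0) (hi : 1 ≤ i) :
    ∑ m ∈ (Finset.Icc 1 n).filter (fun i => r ∣ i), f (m * i) =
      ∑ k ∈ Finset.Icc 1 n, f (i * (r * k)) := by
  have hinj : Set.InjOn (fun k => r * k) (Finset.Icc 1 n : Set ℕ) := by
    intro a _ b _ h
    exact Nat.eq_of_mul_eq_mul_left (show 0 < r by omega) h
  rw [← Finset.sum_image (g := fun k => r * k) (f := fun m => f (i * m)) (by simpa using hinj)]
  simp only [mul_comm i]
  apply Finset.sum_subset
  · intro m hm
    rw [Finset.mem_filter, Finset.mem_Icc] at hm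
    obtain ⟨⟨h1, h2⟩, k, rfl⟩ := hm
    rw [Finset.mem_image]
    refine ⟨k, ?_, rfl⟩
    rw [Finset.mem_Icc]
    constructor
    · rcases Nat.eq_zero_or_pos k with rfl | h
      · simp at h1
      · exact h
    · nlinarith
  · intro m hm hm'
    rw [Finset.mem_image] at hm
    obtain ⟨k, hk, rfl⟩ := hm
    rw [Finset.mem_Icc] at hk
    apply hf
    rw [Finset.mem_filter, Finset.mem_Icc] at hm'
    have h2 : n < r * k := by
      by_contra hc
      exact hm' ⟨⟨by nlinarith, by omega⟩, dvd_mul_right _ _⟩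
    nlinarith

/-- `E_{j,r,t}(n) = (j+1)·|O_{j+1,r}(n)| - j·|O_{j,r}(n)|` for `1 ≤ t ≤ r - 1`. -/
theorem EDiff_eq (n j r t : ℕ) (hr : 2 ≤ r) (ht1 : 1 ≤ t) (ht2 : t ≤ r - 1) :
    EDiff j r t n =
      ((j : ℤ) + 1) * ((setO (j + 1) r n).card : ℤ) - (j : ℤ) * ((setO j r n).card : ℤ) := by
  unfold EDiff
  rw [Finset.sum_sub_distrib, partA n j r t hr ht1]
  have hC := partC n j r
  have hB := partB n j r t hr ht1 ht2
  rw [Finset.sum_comm] at hC ⊢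
  rw [Finset.sum_congr rfl fun i hi => reindex1 n r t i hr ht1 ht2 (hN j r n)
    (hN_zero j r n) (Finset.mem_Icc.mp hi).1]
  rw [Finset.sum_congr rfl fun i hi => reindex2 n r i hr (hN j r n)
    (hN_zero j r n) (Finset.mem_Icc.mp hi).1] at hC
  linarith
end
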